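/- For every x₀ ∈ (0,1) there exists T₀ ∈ [0,+∞] such that: for every finite time T with T > T₀, the heat equation is pointwise observable at x₀ in time T, and for every time T with 0 < T < T₀, the heat equation is not pointwise observable at x₀ in time T. -/

import Mathlib

open MeasureTheory Real Set Filter ENNReal

/-- Solution of the 1D Dirichlet heat equation with initial datum `∑ μₙ sin(nπx)`. -/
noncomputable def heatSol (μ : ℕ+ → ℝ) (t x : ℝ) : ℝ :=
  ∑' n : ℕ+, μ n * Real.exp (-(n : ℝ) ^ 2 * π ^ 2 * t) * Real.sin ((n : ℝ) * π * x)

/-- Pointwise observability of the heat equation at `x₀` in time `T`: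
the infimum of `∫₀ᵀ u_μ(t,x₀)² dt` over normalized square-summable `μ` is positive. -/
noncomputable def PointwiseObservable (x₀ T : ℝ) : Prop :=
  0 < sInf {c : ℝ | ∃ μ : ℕ+ → ℝ, (∑' n : ℕ+, (μ n) ^ 2) = 1 ∧
      c = ∫ t in (0 : ℝ)..T, (heatSol μ t x₀) ^ 2}

lemma exp_neg_le_rpow {y : ℝ} (hy : 0 < y) : Real.exp (-y) ≤ y ^ (-(3 / 8) : ℝ) := by
  rw [Real.exp_neg, Real.rpow_neg hy.le]
  refine inv_anti₀ (Real.rpow_pos_of_pos hy _) ?_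
  calc y ^ (3 / 8 : ℝ) ≤ (Real.exp y) ^ (3 / 8 : ℝ) :=
        Real.rpow_le_rpow hy.le (by linarith [Real.add_one_le_exp y]) (by norm_num)
    _ = Real.exp (y * (3 / 8)) := (Real.exp_mul _ _).symm
    _ ≤ Real.exp y := Real.exp_le_exp.2 (by linarith)

lemma norm_heatSol_term_le (μ : ℕ+ → ℝ) {t : ℝ} (ht : 0 < t) (x : ℝ) (n : ℕ+) :
    ‖μ n * Real.exp (-(n : ℝ) ^ 2 * π ^ 2 * t) * Real.sin ((n : ℝ) * π * x)‖ ≤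
      |μ n| * (n : ℝ) ^ (-(3 / 4) : ℝ) * t ^ (-(3 / 8) : ℝ) := by
  have hn : (0 : ℝ) < n := by exact_mod_cast n.pos
  have hexp : Real.exp (-(n : ℝ) ^ 2 * π ^ 2 * t) ≤
      (n : ℝ) ^ (-(3 / 4) : ℝ) * t ^ (-(3 / 8) : ℝ) := by
    calc Real.exp (-(n : ℝ) ^ 2 * π ^ 2 * t) ≤ Real.exp (-((n : ℝ) ^ 2 * t)) := by
          have hπ : 1 ≤ π ^ 2 := by nlinarith [Real.pi_gt_three]
          have hnt : 0 < (n : ℝ) ^ 2 * t := by positivity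
          exact Real.exp_le_exp.2 (by nlinarith)
      _ ≤ ((n : ℝ) ^ 2 * t) ^ (-(3 / 8) : ℝ) := exp_neg_le_rpow (by positivity)
      _ = _ := by
          rw [Real.mul_rpow (by positivity) ht.le, ← Real.rpow_natCast_mul hn.le]
          norm_num
  rw [Real.norm_eq_abs, abs_mul, abs_mul, Real.abs_exp,
    mul_assoc |μ n|, mul_assoc |μ n|]
  refine mul_le_mul_of_nonneg_left ?_ (abs_nonneg (μ n))
  calc _ ≤ Real.exp (-(n : ℝ) ^ 2 * π ^ 2 * t) * 1 := by
        gcongr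
        exact Real.abs_sin_le_one _
    _ ≤ _ := by rwa [mul_one]

lemma summable_abs_mul_rpow {μ : ℕ+ → ℝ} (hμ : Summable fun n => μ n ^ 2) :
    Summable fun n : ℕ+ => |μ n| * (n : ℝ) ^ (-(3 / 4) : ℝ) := by
  have hp : Summable fun n : ℕ+ => ((n : ℝ) ^ (-(3 / 2) : ℝ)) :=
    (Real.summable_nat_rpow.2 (by norm_num : (-(3 / 2) : ℝ) < -1)).comp_injective
      PNat.coe_injective
  refine (hμ.add hp).of_nonneg_of_le (fun n => by positivity) fun n => ?_
  have hsq : (n : ℝ) ^ (-(3 / 2) : ℝ) = ((n : ℝ) ^ (-(3 / 4) : ℝ)) ^ 2 := by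
    rw [← Real.rpow_mul_natCast (by positivity)]
    norm_num
  rw [hsq, ← sq_abs (μ n)]
  nlinarith [sq_nonneg (|μ n| - (n : ℝ) ^ (-(3 / 4) : ℝ)), sq_nonneg |μ n|,
    sq_nonneg ((n : ℝ) ^ (-(3 / 4) : ℝ))]

lemma summable_heatSol_term {μ : ℕ+ → ℝ} (hμ : Summable fun n => μ n ^ 2) {t : ℝ} (ht : 0 < t)
    (x : ℝ) :
    Summable fun n : ℕ+ =>
      μ n * Real.exp (-(n : ℝ) ^ 2 * π ^ 2 * t) * Real.sin ((n : ℝ) * π * x) :=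
  ((summable_abs_mul_rpow hμ).mul_right _).of_norm_bounded (norm_heatSol_term_le μ ht x)

lemma abs_heatSol_le {μ : ℕ+ → ℝ} (hμ : Summable fun n => μ n ^ 2) {t : ℝ} (ht : 0 < t) (x : ℝ) :
    |heatSol μ t x| ≤ (∑' n : ℕ+, |μ n| * (n : ℝ) ^ (-(3 / 4) : ℝ)) * t ^ (-(3 / 8) : ℝ) :=
  tsum_of_norm_bounded ((summable_abs_mul_rpow hμ).hasSum.mul_right _)
    (norm_heatSol_term_le μ ht x)

lemma intervalIntegrable_heatSol_sq {μ : ℕ+ → ℝ} (hμ : Summable fun n => μ n ^ 2) (x : ℝ)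
    {T : ℝ} (hT : 0 ≤ T) :
    IntervalIntegrable (fun t => heatSol μ t x ^ 2) volume 0 T := by
  set C := ∑' n : ℕ+, |μ n| * (n : ℝ) ^ (-(3 / 4) : ℝ)
  have hdom : IntervalIntegrable (fun t : ℝ => C ^ 2 * t ^ (-(3 / 4) : ℝ)) volume 0 T :=
    (intervalIntegral.intervalIntegrable_rpow' (by norm_num)).const_mul _
  rw [intervalIntegrable_iff_integrableOn_Ioc_of_le hT] at hdom ⊢
  have hmeas : AEStronglyMeasurable (fun t => heatSol μ t x) (volume.restrict (Ioc 0 T)) := by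
    refine aestronglyMeasurable_of_tendsto_ae (atTop : Filter (Finset ℕ+))
      (f := fun s t => ∑ n ∈ s,
        μ n * Real.exp (-(n : ℝ) ^ 2 * π ^ 2 * t) * Real.sin ((n : ℝ) * π * x))
      (fun s => Continuous.aestronglyMeasurable (by fun_prop)) ?_
    filter_upwards [ae_restrict_mem measurableSet_Ioc] with t ht
    exact (summable_heatSol_term hμ ht.1 x).hasSum
  refine hdom.mono' (hmeas.pow 2) ?_
  filter_upwards [ae_restrict_mem measurableSet_Ioc] with t ht
  have hsq : C ^ 2 * t ^ (-(3 / 4) : ℝ) = (C * t ^ (-(3 / 8) : ℝ)) ^ 2 := by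
    rw [mul_pow, ← Real.rpow_mul_natCast ht.1.le]
    norm_num
  rw [hsq, norm_pow]
  exact pow_le_pow_left₀ (norm_nonneg _) (abs_heatSol_le hμ ht.1 x) 2

/-- Observability in some time implies observability in every longer time. -/
lemma PointwiseObservable.mono {x₀ S T : ℝ} (hS : 0 ≤ S) (hST : S ≤ T)
    (h : PointwiseObservable x₀ S) : PointwiseObservable x₀ T := by
  unfold PointwiseObservable at h ⊢
  refine h.trans_le (le_csInf ?_ ?_)
  · exact ⟨_, Pi.single 1 1, by simp [Pi.single_apply], rfl⟩
  · rintro _ ⟨μ, hμ, rfl⟩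
    have hsum : Summable fun n => μ n ^ 2 := by
      by_contra hns
      simp [tsum_eq_zero_of_not_summable hns] at hμ
    refine le_trans (b := ∫ t in (0 : ℝ)..S, heatSol μ t x₀ ^ 2)
      (csInf_le ⟨0, ?_⟩ ⟨μ, hμ, rfl⟩) ?_
    · rintro _ ⟨ν, -, rfl⟩
      exact intervalIntegral.integral_nonneg hS fun t _ => sq_nonneg _
    · exact intervalIntegral.integral_mono_interval le_rfl hS hST
        (Eventually.of_forall fun t => sq_nonneg _)
        (intervalIntegrable_heatSol_sq hsum x₀ (hS.trans hST))

/-- For every `x₀ ∈ (0,1)` there exists `T₀ ∈ [0,+∞]` such that the heat equation is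
pointwise observable at `x₀` in every finite time `T > T₀` and not pointwise observable
at `x₀` in any time `0 < T < T₀`. -/
theorem exists_minimal_pointwise_control_time (x₀ : ℝ) (hx₀ : x₀ ∈ Set.Ioo (0 : ℝ) 1) :
    ∃ T₀ : ℝ≥0∞, ∀ T : ℝ, 0 < T →
      ((T₀ < ENNReal.ofReal T → PointwiseObservable x₀ T) ∧
       (ENNReal.ofReal T < T₀ → ¬ PointwiseObservable x₀ T)) := by
  refine ⟨sInf (ENNReal.ofReal '' {S | 0 < S ∧ PointwiseObservable x₀ S}), fun T hT =>
    ⟨fun h => ?_, fun h hobs => ?_⟩⟩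
  · obtain ⟨_, ⟨S, ⟨hS, hobs⟩, rfl⟩, hlt⟩ := sInf_lt_iff.1 h
    exact hobs.mono hS.le ((ENNReal.ofReal_lt_ofReal_iff hT).1 hlt).le
  · exact h.not_ge (sInf_le ⟨T, ⟨hT, hobs⟩, rfl⟩)
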